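/- There is a universal constant c > 0 with the following property. Let n ≥ 2, set h = 1/√(2 log n), and let μ_i, K_i ∈ ℝ, σ_i > 0, and thresholds d_i ∈ ℝ for i = 1,…,n. Let Y₁,…,Y_n be independent with Y_i ~ N(μ_i, σ_i²) and let Ŵ_n = (1/n) Σ_i Ψ_h^{(i)}(Y_i), where Ψ_h^{(i)}(y) = (y − K_i)·Csinc((y − d_i)/(σ_i h)) − (σ_i/h)·sinc((y − d_i)/(σ_i h)). Then Var(Ŵ_n) ≤ c [ ((log n)²/n) · (1/n) Σ_{i=1}^n σ_i² + ((log n)/n) · (1/n) Σ_{i=1}^n (d_i − K_i)² ]. -/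

import Mathlib

open MeasureTheory ProbabilityTheory

/-- sinc kernel, normalized by π -/
noncomputable def sincR (x : ℝ) : ℝ := if x = 0 then 1 / Real.pi else Real.sin x / (Real.pi * x)

/-- sine integral -/
noncomputable def SiR (x : ℝ) : ℝ := ∫ t in (0:ℝ)..x, Real.sin t / t

/-- cumulative sinc -/
noncomputable def CsincR (x : ℝ) : ℝ := 1 / 2 + SiR x / Real.pi


lemma SiR_eq (x : ℝ) : SiR x = ∫ t in (0:ℝ)..x, Real.sinc t := by
  unfold SiR
  apply intervalIntegral.integral_congr_ae
  have h : ∀ᵐ t : ℝ, t ≠ 0 := by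
    simp [ae_iff, measure_singleton]
  filter_upwards [h] with t ht _
  rw [Real.sinc_of_ne_zero ht]

lemma SiR_hasDerivAt (x : ℝ) : HasDerivAt SiR (Real.sinc x) x := by
  have : SiR = fun x => ∫ t in (0:ℝ)..x, Real.sinc t := funext SiR_eq
  rw [this]
  exact intervalIntegral.integral_hasDerivAt_right
    (Real.continuous_sinc.intervalIntegrable _ _)
    (Real.continuous_sinc.stronglyMeasurableAtFilter _ _) Real.continuous_sinc.continuousAt

lemma SiR_neg (x : ℝ) : SiR (-x) = - SiR x := by
  rw [SiR_eq, SiR_eq, intervalIntegral.integral_symm]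
  have := intervalIntegral.integral_comp_neg (a := 0) (b := x) (fun t => Real.sinc t)
  simp only [Real.sinc_neg, neg_zero] at this
  rw [← this]

lemma SiR_small {x : ℝ} (h0 : 0 ≤ x) (h1 : x ≤ 1) : |SiR x| ≤ 1 := by
  rw [SiR_eq]
  have := intervalIntegral.norm_integral_le_of_norm_le_const (a := 0) (b := x) (C := 1)
    (f := Real.sinc) (fun t _ => by simpa using Real.abs_sinc_le_one t)
  rw [Real.norm_eq_abs] at this
  rw [sub_zero, abs_of_nonneg h0] at this
  linarith

lemma SiR_aux (s : ℝ) {x : ℝ} (hx : 0 < x) :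
    HasDerivAt (fun x => SiR x + Real.cos x * x⁻¹ + s * x⁻¹)
      (-(Real.cos x + s) * (x ^ 2)⁻¹) x := by
  have h1 := ((SiR_hasDerivAt x).add ((Real.hasDerivAt_cos x).mul (hasDerivAt_inv hx.ne'))).add
    ((hasDerivAt_inv hx.ne').const_mul s)
  refine h1.congr_deriv ?_
  rw [Real.sinc_of_ne_zero hx.ne']
  field_simp
  ring

lemma SiR_large {x : ℝ} (hx : 1 ≤ x) : |SiR x| ≤ 3 := by
  have hs := abs_le.1 (SiR_small (x := 1) zero_le_one le_rfl)
  have hcont : ∀ s : ℝ, ContinuousOn (fun x => SiR x + Real.cos x * x⁻¹ + s * x⁻¹)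
      (Set.Ici 1) := fun s y hy =>
    (SiR_aux s (lt_of_lt_of_le one_pos hy)).continuousAt.continuousWithinAt
  have hA : AntitoneOn (fun x => SiR x + Real.cos x * x⁻¹ + 1 * x⁻¹) (Set.Ici 1) := by
    apply antitoneOn_of_deriv_nonpos (convex_Ici 1) (hcont 1)
    · intro y hy
      rw [interior_Ici] at hy
      exact (SiR_aux 1 (lt_trans one_pos hy)).differentiableAt.differentiableWithinAt
    · intro y hy
      rw [interior_Ici] at hy
      rw [(SiR_aux 1 (lt_trans one_pos hy)).deriv]
      have := Real.neg_one_le_cos y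
      exact mul_nonpos_of_nonpos_of_nonneg (by linarith) (by positivity)
  have hM : MonotoneOn (fun x => SiR x + Real.cos x * x⁻¹ + (-1) * x⁻¹) (Set.Ici 1) := by
    apply monotoneOn_of_deriv_nonneg (convex_Ici 1) (hcont (-1))
    · intro y hy
      rw [interior_Ici] at hy
      exact (SiR_aux (-1) (lt_trans one_pos hy)).differentiableAt.differentiableWithinAt
    · intro y hy
      rw [interior_Ici] at hy
      rw [(SiR_aux (-1) (lt_trans one_pos hy)).deriv]
      have := Real.cos_le_one y
      exact mul_nonneg (by linarith) (by positivity)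
  have a := hA (Set.mem_Ici.2 le_rfl) (Set.mem_Ici.2 hx) hx
  have m := hM (Set.mem_Ici.2 le_rfl) (Set.mem_Ici.2 hx) hx
  simp only [inv_one, mul_one] at a m
  have hp : 0 < x⁻¹ := by positivity
  have c1 := Real.cos_le_one x
  have c2 := Real.neg_one_le_cos x
  have c3 := Real.cos_le_one 1
  have c4 := Real.neg_one_le_cos 1
  have e1 : 0 ≤ (Real.cos x + 1) * x⁻¹ := mul_nonneg (by linarith) hp.le
  have e2 : 0 ≤ (1 - Real.cos x) * x⁻¹ := mul_nonneg (by linarith) hp.le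
  rw [abs_le]
  constructor <;> nlinarith

lemma SiR_bound (x : ℝ) : |SiR x| ≤ 3 := by
  have key : ∀ y : ℝ, 0 ≤ y → |SiR y| ≤ 3 := by
    intro y hy
    rcases le_total y 1 with h | h
    · linarith [SiR_small hy h]
    · exact SiR_large h
  rcases le_total 0 x with h | h
  · exact key x h
  · have := key (-x) (by linarith)
    rwa [SiR_neg, abs_neg] at this

lemma CsincR_bound (x : ℝ) : |CsincR x| ≤ 2 := by
  unfold CsincR
  have h := abs_le.1 (SiR_bound x)
  have hpi := Real.pi_gt_three
  have h1 : SiR x / Real.pi ≤ 1 := by rw [div_le_iff₀ (by linarith)]; linarith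
  have h2 : -1 ≤ SiR x / Real.pi := by rw [le_div_iff₀ (by linarith)]; linarith
  rw [abs_le]; constructor <;> linarith

lemma CsincR_hasDerivAt (x : ℝ) : HasDerivAt CsincR (Real.sinc x / Real.pi) x :=
  ((SiR_hasDerivAt x).div_const Real.pi).const_add (1/2)

lemma sincR_eq (x : ℝ) : sincR x = Real.sinc x / Real.pi := by
  unfold sincR
  split_ifs with h
  · simp [h]
  · rw [Real.sinc_of_ne_zero h]; field_simp

lemma sincR_bound (x : ℝ) : |sincR x| ≤ 1 := by
  rw [sincR_eq, abs_div, abs_of_pos Real.pi_pos, div_le_one Real.pi_pos]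
  linarith [Real.abs_sinc_le_one x, Real.pi_gt_three]

lemma wC_lip (x y : ℝ) : |x * CsincR x - y * CsincR y| ≤ 3 * |x - y| := by
  have h : ∀ z ∈ (Set.univ : Set ℝ), HasDerivWithinAt (fun w => w * CsincR w)
      (1 * CsincR z + z * (Real.sinc z / Real.pi)) Set.univ z := fun z _ =>
    ((hasDerivAt_id z).mul (CsincR_hasDerivAt z)).hasDerivWithinAt
  refine convex_univ.norm_image_sub_le_of_norm_hasDerivWithin_le h ?_ (Set.mem_univ y)
    (Set.mem_univ x)
  intro z _
  have e : z * (Real.sinc z / Real.pi) = Real.sin z / Real.pi := by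
    by_cases hz : z = 0
    · simp [hz]
    · rw [Real.sinc_of_ne_zero hz]; field_simp
  have h2 : |Real.sin z / Real.pi| ≤ 1 := by
    rw [abs_div, abs_of_pos Real.pi_pos, div_le_one Real.pi_pos]
    linarith [Real.abs_sin_le_one z, Real.pi_gt_three]
  rw [e, one_mul, Real.norm_eq_abs]
  linarith [abs_add_le (CsincR z) (Real.sin z / Real.pi), CsincR_bound z]

/-- a single coordinate of the estimator -/
noncomputable def PsiR (K σ d h y : ℝ) : ℝ :=
  (y - K) * CsincR ((y - d) / (σ * h)) - (σ / h) * sincR ((y - d) / (σ * h))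

lemma PsiR_cont (K σ d h : ℝ) : Continuous (PsiR K σ d h) := by
  have h1 : Continuous CsincR :=
    continuous_iff_continuousAt.2 fun x => (CsincR_hasDerivAt x).continuousAt
  have h2 : Continuous sincR := by
    rw [show sincR = fun x => Real.sinc x / Real.pi from funext sincR_eq]
    exact Real.continuous_sinc.div_const _
  unfold PsiR
  fun_prop

lemma PsiR_dev {K σ d h : ℝ} (hσ : 0 < σ) (hh : 0 < h) (m y : ℝ) :
    (PsiR K σ d h y - (m - d) * CsincR ((m - d) / (σ * h))) ^ 2
      ≤ 18 * (y - m) ^ 2 + (16 * (d - K) ^ 2 + 4 * (σ / h) ^ 2) := by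
  have hp : 0 < σ * h := by positivity
  have hL := wC_lip ((y - d) / (σ * h)) ((m - d) / (σ * h))
  set u := (y - d) / (σ * h) with hu
  set v := (m - d) / (σ * h) with hv
  have hy : y - d = σ * h * u := by rw [hu]; field_simp
  have hm : m - d = σ * h * v := by rw [hv]; field_simp
  have hym : y - m = σ * h * (u - v) := by linarith
  set A := σ * h * (u * CsincR u - v * CsincR v) with hA
  have hA2 : A ^ 2 ≤ 9 * (y - m) ^ 2 := by
    have : |A| ≤ |3 * (y - m)| := by
      rw [hA, hym, abs_mul, abs_mul 3, abs_mul (σ * h), abs_of_pos hp]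
      have := mul_le_mul_of_nonneg_left hL hp.le
      rw [abs_of_pos (by norm_num : (0:ℝ) < 3)]
      linarith
    have := sq_le_sq.2 this
    linarith
  have hB : ((d - K) * CsincR u) ^ 2 ≤ 4 * (d - K) ^ 2 := by
    have h1 : CsincR u ^ 2 ≤ 4 := by
      have := sq_le_sq' (abs_le.1 (CsincR_bound u)).1 (abs_le.1 (CsincR_bound u)).2
      linarith
    rw [mul_pow]; nlinarith [sq_nonneg (d - K)]
  have hC : ((σ / h) * sincR u) ^ 2 ≤ (σ / h) ^ 2 := by
    have h1 : sincR u ^ 2 ≤ 1 := by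
      have := sq_le_sq' (abs_le.1 (sincR_bound u)).1 (abs_le.1 (sincR_bound u)).2
      linarith
    rw [mul_pow]; nlinarith [sq_nonneg (σ / h)]
  have e : PsiR K σ d h y - (m - d) * CsincR v
      = A + ((d - K) * CsincR u - (σ / h) * sincR u) := by
    unfold PsiR
    rw [← hu, hA]
    have : y - K = σ * h * u + (d - K) := by linarith
    rw [this, hm]; ring
  rw [e]
  set B := (d - K) * CsincR u
  set C := (σ / h) * sincR u
  nlinarith [sq_nonneg (A - (B - C)), sq_nonneg (B + C)]

lemma PsiR_memLp {K σ d h : ℝ} (hσ : 0 < σ) (hh : 0 < h) (m : ℝ) :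
    MemLp (PsiR K σ d h) 2 (gaussianReal m ((σ ^ 2).toNNReal)) ∧
    variance (PsiR K σ d h) (gaussianReal m ((σ ^ 2).toNNReal))
      ≤ 18 * σ ^ 2 + (16 * (d - K) ^ 2 + 4 * (σ / h) ^ 2) := by
  set ν := gaussianReal m ((σ ^ 2).toNNReal) with hν
  set a := (m - d) * CsincR ((m - d) / (σ * h))
  set M := 16 * (d - K) ^ 2 + 4 * (σ / h) ^ 2
  have hid : MemLp (fun y : ℝ => y) 2 ν := memLp_id_gaussianReal 2
  have hidm : MemLp (fun y : ℝ => y - m) 2 ν := hid.sub (memLp_const m)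
  have hsq : Integrable (fun y : ℝ => (y - m) ^ 2) ν := hidm.integrable_sq
  have hG : Integrable (fun y : ℝ => 18 * (y - m) ^ 2 + M) ν :=
    (hsq.const_mul 18).add (integrable_const M)
  have hmeas : AEStronglyMeasurable (fun y => PsiR K σ d h y - a) ν :=
    ((PsiR_cont K σ d h).sub continuous_const).aestronglyMeasurable
  have hI : Integrable (fun y => (PsiR K σ d h y - a) ^ 2) ν := by
    refine hG.mono' (hmeas.pow 2) (Filter.Eventually.of_forall fun y => ?_)
    rw [Real.norm_eq_abs, abs_of_nonneg (sq_nonneg _)]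
    exact PsiR_dev hσ hh m y
  have hL : MemLp (fun y => PsiR K σ d h y - a) 2 ν := (memLp_two_iff_integrable_sq hmeas).2 hI
  constructor
  · have := hL.add (memLp_const a)
    refine this.congr_norm ?_ ?_
    · exact (PsiR_cont K σ d h).aestronglyMeasurable
    · exact Filter.Eventually.of_forall fun y => by simp
  · have hv : ∫ y, (y - m) ^ 2 ∂ν = σ ^ 2 := by
      have h1 := variance_eq_integral (μ := ν) (X := fun y : ℝ => y) aemeasurable_id
      have h2 : ∫ y, y ∂ν = m := integral_id_gaussianReal
      rw [h2] at h1
      rw [← h1, hν, variance_fun_id_gaussianReal, Real.coe_toNNReal _ (sq_nonneg σ)]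
    rw [← variance_sub_const (PsiR_cont K σ d h).aestronglyMeasurable a]
    calc _ ≤ ∫ y, (PsiR K σ d h y - a) ^ 2 ∂ν := variance_le_expectation_sq hmeas
      _ ≤ ∫ y, (18 * (y - m) ^ 2 + M) ∂ν :=
        integral_mono hI hG fun y => PsiR_dev hσ hh m y
      _ = 18 * σ ^ 2 + M := by
        rw [integral_add (hsq.const_mul 18) (integrable_const M), integral_const_mul, hv]
        simp

/-- variance bound for the ASSURE estimator with bandwidth
`h = 1/√(2 log n)`. -/
theorem assure_variance_bound :
    ∃ c : ℝ, 0 < c ∧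
      ∀ n : ℕ, 2 ≤ n → ∀ h : ℝ, h = 1 / Real.sqrt (2 * Real.log n) →
      ∀ μ K σ d : Fin n → ℝ, (∀ i, 0 < σ i) →
        variance
          (fun y : Fin n → ℝ => (1 / (n:ℝ)) * ∑ i,
            ((y i - K i) * CsincR ((y i - d i) / (σ i * h))
              - (σ i / h) * sincR ((y i - d i) / (σ i * h))))
          (Measure.pi fun i => gaussianReal (μ i) ((σ i ^ 2).toNNReal))
        ≤ c * (((Real.log n) ^ 2 / n) * ((1 / (n:ℝ)) * ∑ i, (σ i) ^ 2)
            + ((Real.log n) / n) * ((1 / (n:ℝ)) * ∑ i, (d i - K i) ^ 2)) := by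
  refine ⟨100, by norm_num, ?_⟩
  intro n hn h hh μ K σ d hσ
  have hn' : (2:ℝ) ≤ n := by exact_mod_cast hn
  have hl : 0.69 ≤ Real.log n := by
    have := Real.log_le_log (by norm_num) hn'
    linarith [Real.log_two_gt_d9]
  set l := Real.log n
  have hpos : 0 < h := by
    rw [hh]; exact one_div_pos.2 (Real.sqrt_pos.2 (by linarith))
  have hinv : ∀ s : ℝ, (s / h) ^ 2 = 2 * l * s ^ 2 := by
    intro s
    rw [hh, div_div_eq_mul_div, div_one, mul_pow, Real.sq_sqrt (by linarith)]
    ring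
  have hvar := variance_sum_pi (μ := fun i => gaussianReal (μ i) ((σ i ^ 2).toNNReal))
    (X := fun i => PsiR (K i) (σ i) (d i) h) (fun i => (PsiR_memLp (hσ i) hpos (μ i)).1)
  rw [variance_const_mul]
  have e : (fun y : Fin n → ℝ => ∑ i,
            ((y i - K i) * CsincR ((y i - d i) / (σ i * h))
              - (σ i / h) * sincR ((y i - d i) / (σ i * h))))
      = ∑ i, fun y : Fin n → ℝ => PsiR (K i) (σ i) (d i) h (y i) := by
    ext y
    simp [PsiR, Finset.sum_apply]
  rw [e, hvar]
  have hb : ∑ i, variance (PsiR (K i) (σ i) (d i) h) (gaussianReal (μ i) ((σ i ^ 2).toNNReal))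
      ≤ ∑ i, 100 * (l ^ 2 * σ i ^ 2 + l * (d i - K i) ^ 2) := by
    refine Finset.sum_le_sum fun i _ => ((PsiR_memLp (hσ i) hpos (μ i)).2).trans ?_
    rw [hinv]
    have h1 : 18 + 8 * l ≤ 100 * l ^ 2 := by nlinarith
    have h2 : 16 ≤ 100 * l := by linarith
    nlinarith [mul_le_mul_of_nonneg_right h1 (sq_nonneg (σ i)),
      mul_le_mul_of_nonneg_right h2 (sq_nonneg (d i - K i))]
  refine (mul_le_mul_of_nonneg_left hb (sq_nonneg _)).trans (le_of_eq ?_)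
  rw [← Finset.mul_sum, Finset.sum_add_distrib, ← Finset.mul_sum, ← Finset.mul_sum]
  field_simp
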